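/- arXiv:2310.10242 — 2 statements merged into one kernel-verified Lean document; each statement's English description precedes it below -/
import Mathlib

section
/- Suppose in addition that E is symmetric (E = E^T). For each integer d ≥ 1, the entropy h(Y^{(d)}_E) = lim_{n→∞} log|{restrictions to B_n of elements of Y^{(d)}_E}| / |B_n| exists, and h(Y^{(d)}_E) is monotone increasing in d. -/
open Filter Topology

/-- Assumption (A): `E` has nonnegative entries with all column sums and row sums positive. -/
def AssumptionA {A : Type*} [Fintype A] (E : Matrix A A ℝ) : Prop :=
  (∀ a b, 0 ≤ E a b) ∧ (∀ b, 0 < ∑ a, E a b) ∧ (∀ a, 0 < ∑ b, E a b)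

/-- The Markov shift `Y^{(d)}_E` over the free group on `d` generators. -/
def freeMarkov {A : Type*} (d : ℕ) (E : Matrix A A ℝ) : Set (FreeGroup (Fin d) → A) :=
  {x | ∀ g : FreeGroup (Fin d), ∀ i : Fin d, 0 < E (x (g * FreeGroup.of i)) (x g)}

/-- The closed ball `B_n` of radius `n` about the identity in the word metric of the free
group on `d` generators. -/
def freeBall (d n : ℕ) : Set (FreeGroup (Fin d)) :=
  {g | FreeGroup.norm g ≤ n}

/-- The set of restrictions to `B_n` of elements of `Y^{(d)}_E`. -/
def freeBlocks {A : Type*} (d : ℕ) (E : Matrix A A ℝ) (n : ℕ) :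
    Set (freeBall d n → A) :=
  {u | ∃ x ∈ freeMarkov d E, ∀ g : freeBall d n, u g = x (g : FreeGroup (Fin d))}

namespace FMS

open FreeGroup

/-- parent of a vertex in the Cayley tree -/
def par {d : ℕ} (g : FreeGroup (Fin d)) : FreeGroup (Fin d) := FreeGroup.mk (g.toWord.dropLast)

lemma toWord_par {d : ℕ} (g : FreeGroup (Fin d)) : (par g).toWord = g.toWord.dropLast := by
  unfold par
  rw [toWord_mk]
  apply IsReduced.reduce_eq
  exact (isReduced_toWord (x := g)).infix (List.dropLast_prefix _).isInfix

lemma norm_par {d : ℕ} (g : FreeGroup (Fin d)) : norm (par g) = norm g - 1 := by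
  unfold FreeGroup.norm
  rw [toWord_par]; simp

lemma exists_par {d : ℕ} (g : FreeGroup (Fin d)) (hg : g ≠ 1) :
    ∃ s : Fin d × Bool, g * mk [s] = par g := by
  have hne : g.toWord ≠ [] := by simpa using hg
  obtain ⟨x, hx⟩ : ∃ x, x = g.toWord.getLast hne := ⟨_, rfl⟩
  refine ⟨(x.1, !x.2), ?_⟩
  have h1 : par g * mk [x] = g := by
    conv_rhs => rw [← mk_toWord (x := g), ← List.dropLast_append_getLast hne, ← hx]
    rw [← mul_mk]; rfl
  have h2 : (mk [(x.1, !x.2)] : FreeGroup (Fin d)) = (mk [x])⁻¹ := by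
    rw [inv_mk]; simp [invRev]
  rw [h2, mul_inv_eq_iff_eq_mul, h1]

lemma child_spec {d : ℕ} (g : FreeGroup (Fin d)) (s : Fin d × Bool)
    (h : g = 1 ∨ g * mk [s] ≠ par g) :
    par (g * mk [s]) = g ∧ norm (g * mk [s]) = norm g + 1 := by
  have key : (g * mk [s]).toWord = g.toWord ++ [s] := by
    have : g * mk [s] = mk (g.toWord ++ [s]) := by
      rw [← mul_mk, mk_toWord]
    rw [this, toWord_mk]
    apply IsReduced.reduce_eq
    unfold FreeGroup.IsReduced
    rw [List.isChain_append]
    refine ⟨isReduced_toWord, by simp, ?_⟩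
    intro x hx y hy hxy
    simp at hy
    subst hy
    by_contra hne
    have hg : g.toWord ≠ [] := by rintro h0; simp [h0] at hx
    rw [List.getLast?_eq_getLast_of_ne_nil hg] at hx
    simp at hx
    have hs : s = (x.1, !x.2) := by
      ext
      · exact hxy.symm ▸ rfl
      · cases h1 : x.2 <;> cases h2 : s.2 <;> simp_all
    rcases h with h | h
    · simp [h] at hg
    · apply h
      have h1 : g = par g * mk [x] := by
        conv_lhs => rw [← mk_toWord (x := g), ← List.dropLast_append_getLast hg, hx]
        rw [← mul_mk]; rfl
      conv_lhs => rw [h1]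
      have : (mk [s] : FreeGroup (Fin d)) = (mk [x])⁻¹ := by
        rw [inv_mk, hs]; simp [invRev]
      rw [this, mul_inv_cancel_right]
  constructor
  · apply toWord_injective
    rw [toWord_par, key]; simp
  · unfold FreeGroup.norm; rw [key]; simp

lemma mk_singleton_inj {d : ℕ} : Function.Injective
    (fun s : Fin d × Bool => (mk [s] : FreeGroup (Fin d))) := by
  intro s t h
  have := congrArg toWord h
  simpa [toWord_mk, reduce_singleton] using this

open Classical in
lemma children {d : ℕ} (g : FreeGroup (Fin d)) :
    ∃ C : Finset (FreeGroup (Fin d)), C.card = (if norm g = 0 then 2 * d else 2 * d - 1) ∧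
      ∀ c, c ∈ C ↔ norm c = norm g + 1 ∧ par c = g := by
  have hinj : Function.Injective (fun s : Fin d × Bool => g * mk [s]) :=
    (mul_right_injective g).comp mk_singleton_inj
  -- all children are neighbours
  have hch : ∀ c : FreeGroup (Fin d), norm c = norm g + 1 → par c = g →
      ∃ s, c = g * mk [s] := by
    intro c h1 h2
    have hc : c ≠ 1 := by rintro rfl; simp at h1
    obtain ⟨s, hs⟩ := exists_par c hc
    refine ⟨(s.1, !s.2), ?_⟩
    have : (mk [(s.1, !s.2)] : FreeGroup (Fin d)) = (mk [s])⁻¹ := by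
      rw [inv_mk]; simp [invRev]
    rw [this, ← h2, ← hs, mul_inv_cancel_right]
  by_cases hg : g = 1
  · refine ⟨Finset.univ.image (fun s : Fin d × Bool => g * mk [s]), ?_, ?_⟩
    · rw [Finset.card_image_of_injective _ hinj]
      simp [hg]; ring
    · intro c
      simp only [Finset.mem_image, Finset.mem_univ, true_and]
      constructor
      · rintro ⟨s, rfl⟩
        exact (child_spec g s (Or.inl hg)).symm
      · rintro ⟨h1, h2⟩
        obtain ⟨s, hs⟩ := hch c h1 h2
        exact ⟨s, hs.symm⟩
  · obtain ⟨t, ht⟩ := exists_par g hg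
    refine ⟨(Finset.univ.erase t).image (fun s : Fin d × Bool => g * mk [s]), ?_, ?_⟩
    · rw [Finset.card_image_of_injective _ hinj]
      have : norm g ≠ 0 := by simpa using hg
      simp [this, mul_comm]
    · intro c
      simp only [Finset.mem_image, Finset.mem_erase, Finset.mem_univ, and_true]
      constructor
      · rintro ⟨s, hs, rfl⟩
        refine (child_spec g s (Or.inr ?_)).symm
        intro h
        exact hs (hinj (h.trans ht.symm))
      · rintro ⟨h1, h2⟩
        obtain ⟨s, hs⟩ := hch c h1 h2
        refine ⟨s, ?_, hs.symm⟩
        rintro rfl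
        rw [ht] at hs
        rw [hs, norm_par] at h1
        omega

lemma edge_cases {d : ℕ} (g : FreeGroup (Fin d)) (i : Fin d) :
    (par (g * of i) = g ∧ norm (g * of i) = norm g + 1) ∨
    (g ≠ 1 ∧ par g = g * of i) := by
  have : (of i : FreeGroup (Fin d)) = mk [(i, true)] := rfl
  rw [this]
  by_cases h : g = 1 ∨ g * mk [(i, true)] ≠ par g
  · exact Or.inl (child_spec g _ h)
  · push Not at h
    exact Or.inr ⟨h.1, h.2.symm⟩

end FMS
namespace FMS

section tree
open Classical

variable {X A : Type*} [Fintype A]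

/-- combinatorial tree data: parent map, level function, finite balls. -/
structure LTree (X : Type*) where
  p : X → X
  lev : X → ℕ
  o : X
  ball : ℕ → Finset X
  kap : ℕ → ℕ
  lev_o : ∀ g, lev g = 0 ↔ g = o
  lev_p : ∀ g, lev (p g) = lev g - 1
  mem_ball : ∀ n g, g ∈ ball n ↔ lev g ≤ n
  ch : ∀ g, ∃ C : Finset X, C.card = kap (lev g) ∧ ∀ c, c ∈ C ↔ lev c = lev g + 1 ∧ p c = g

lemma LTree.p_mem (T : LTree X) {n : ℕ} (g : T.ball n) : T.p g ∈ T.ball n := by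
  have := g.2
  rw [T.mem_ball] at this ⊢
  rw [T.lev_p]; omega

/-- weighted count of colourings -/
noncomputable def LTree.Z (T : LTree X) (Q : A → A → ℝ) (n : ℕ) (f : A → ℝ) : ℝ :=
  ∑ u : T.ball n → A, (∏ g : T.ball n, if T.lev g = 0 then 1 else Q (u ⟨T.p g, T.p_mem g⟩) (u g)) *
    ∏ g : T.ball n, if T.lev g = n then f (u g) else 1

/-- the sphere -/
noncomputable def LTree.sph (T : LTree X) (n : ℕ) : Finset X := (T.ball n).filter (fun g => T.lev g = n)

lemma LTree.mem_sph (T : LTree X) (n : ℕ) (g : X) : g ∈ T.sph n ↔ T.lev g = n := by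
  simp only [LTree.sph, Finset.mem_filter, T.mem_ball]
  omega

/-- splitting of the ball -/
noncomputable def LTree.split (T : LTree X) (n : ℕ) : T.ball n ⊕ T.sph (n+1) ≃ T.ball (n+1) :=
  Equiv.ofBijective (Sum.elim
    (fun g => ⟨g, by have := g.2; rw [T.mem_ball] at this ⊢; omega⟩)
    (fun g => ⟨g, by have := g.2; rw [T.mem_sph] at this; rw [T.mem_ball]; omega⟩)) (by
    constructor
    · rintro (⟨a, ha⟩ | ⟨a, ha⟩) (⟨b, hb⟩ | ⟨b, hb⟩) h <;>
        simp only [Sum.elim_inl, Sum.elim_inr, Subtype.mk.injEq] at h <;> subst h <;>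
        simp only [T.mem_ball, T.mem_sph] at ha hb <;> first | rfl | omega
    · rintro ⟨b, hb⟩
      rw [T.mem_ball] at hb
      by_cases h : T.lev b ≤ n
      · exact ⟨Sum.inl ⟨b, (T.mem_ball _ _).2 h⟩, rfl⟩
      · exact ⟨Sum.inr ⟨b, (T.mem_sph _ _).2 (by omega)⟩, rfl⟩)

lemma LTree.split_inl (T : LTree X) (n : ℕ) (g : T.ball n) : ((T.split n (Sum.inl g)) : X) = g := rfl
lemma LTree.split_inr (T : LTree X) (n : ℕ) (g : T.sph (n+1)) :
    ((T.split n (Sum.inr g)) : X) = g := rfl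

lemma LTree.p_mem' (T : LTree X) {n : ℕ} (g : T.sph (n+1)) : T.p g ∈ T.ball n := by
  have := g.2
  rw [T.mem_sph] at this
  rw [T.mem_ball, T.lev_p]; omega

lemma LTree.prod_sph (T : LTree X) (n : ℕ) (F : T.ball n → ℝ) :
    ∏ c : T.sph (n+1), F ⟨T.p c, T.p_mem' c⟩ =
      ∏ g : T.ball n, if T.lev g = n then F g ^ (T.kap n) else 1 := by
  rw [← Finset.prod_fiberwise (s := Finset.univ)
    (g := fun c : T.sph (n+1) => (⟨T.p c, T.p_mem' c⟩ : T.ball n))]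
  apply Finset.prod_congr rfl
  intro g _
  have h1 : ∀ c ∈ Finset.univ.filter
      (fun c : T.sph (n+1) => (⟨T.p c, T.p_mem' c⟩ : T.ball n) = g),
      F ⟨T.p c, T.p_mem' c⟩ = F g := by
    intro c hc
    rw [(Finset.mem_filter.1 hc).2]
  rw [Finset.prod_congr rfl h1, Finset.prod_const]
  split_ifs with h
  · congr 1
    obtain ⟨C, hC, hC'⟩ := T.ch g
    rw [h] at hC hC'
    rw [← hC]
    apply Finset.card_bij (fun (c : T.sph (n+1)) _ => (c : X))
    · intro c hc
      rw [hC']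
      refine ⟨(T.mem_sph _ _).1 c.2, ?_⟩
      have := (Finset.mem_filter.1 hc).2
      exact congrArg Subtype.val this
    · intro a _ b _ hab
      exact Subtype.ext hab
    · intro c hc
      rw [hC'] at hc
      exact ⟨⟨c, (T.mem_sph _ _).2 hc.1⟩, by simp [hc.2], rfl⟩
  · rw [Finset.card_eq_zero.2, pow_zero]
    rw [Finset.filter_eq_empty_iff]
    intro c _ hc
    apply h
    rw [← hc, T.lev_p, (T.mem_sph _ _).1 c.2]; omega

lemma LTree.Z_succ (T : LTree X) (Q : A → A → ℝ) (n : ℕ) (f : A → ℝ) :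
    T.Z Q (n+1) f = T.Z Q n (fun a => (∑ b, Q a b * f b) ^ (T.kap n)) := by
  unfold LTree.Z
  rw [← Equiv.sum_comp ((Equiv.sumArrowEquivProdArrow _ _ A).symm.trans
    (Equiv.arrowCongr (T.split n) (Equiv.refl A)))]
  rw [Fintype.sum_prod_type]
  apply Finset.sum_congr rfl
  intro v _
  have e1 : ∀ (φ : T.sph (n+1) → A) (x : T.ball n ⊕ T.sph (n+1)),
      (((Equiv.sumArrowEquivProdArrow _ _ A).symm.trans
    (Equiv.arrowCongr (T.split n) (Equiv.refl A))) (v, φ)) (T.split n x) = Sum.elim v φ x := by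
    intro φ x
    rcases x with x | x <;>
      simp [Equiv.arrowCongr, Equiv.sumArrowEquivProdArrow]
  have e2 : ∀ (φ : T.sph (n+1) → A) (x : T.ball (n+1)) (y : T.ball n), (x : X) = y →
      (((Equiv.sumArrowEquivProdArrow _ _ A).symm.trans
    (Equiv.arrowCongr (T.split n) (Equiv.refl A))) (v, φ)) x = v y := by
    intro φ x y h
    have : x = T.split n (Sum.inl y) := Subtype.ext h
    rw [this, e1]; rfl
  have e3 : ∀ φ : T.sph (n+1) → A,
      (∏ g : T.ball (n+1), if T.lev g = 0 then 1 else
        Q ((((Equiv.sumArrowEquivProdArrow _ _ A).symm.trans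
    (Equiv.arrowCongr (T.split n) (Equiv.refl A))) (v, φ)) ⟨T.p g, T.p_mem g⟩)
          ((((Equiv.sumArrowEquivProdArrow _ _ A).symm.trans
    (Equiv.arrowCongr (T.split n) (Equiv.refl A))) (v, φ)) g)) *
      (∏ g : T.ball (n+1), if T.lev g = n+1 then f ((((Equiv.sumArrowEquivProdArrow _ _ A).symm.trans
    (Equiv.arrowCongr (T.split n) (Equiv.refl A))) (v, φ)) g) else 1) =
      (∏ g : T.ball n, if T.lev g = 0 then 1 else Q (v ⟨T.p g, T.p_mem g⟩) (v g)) *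
      ∏ c : T.sph (n+1), (Q (v ⟨T.p c, T.p_mem' c⟩) (φ c) * f (φ c)) := by
    intro φ
    rw [← Equiv.prod_comp (T.split n), ← Equiv.prod_comp (T.split n)
      (fun g : T.ball (n+1) => if T.lev g = n+1 then f (_) else 1)]
    rw [Fintype.prod_sum_type, Fintype.prod_sum_type]
    have a1 : ∀ g : T.ball n, T.lev ((T.split n (Sum.inl g) : T.ball (n+1)) : X) ≠ n+1 := by
      intro g
      have := (T.mem_ball _ _).1 g.2
      rw [T.split_inl]; omega
    have a2 : ∀ g : T.sph (n+1), T.lev ((T.split n (Sum.inr g) : T.ball (n+1)) : X) = n+1 := by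
      intro g
      rw [T.split_inr]; exact (T.mem_sph _ _).1 g.2
    simp only [a1, a2, if_false, if_true, Finset.prod_const_one, one_mul, e1, Sum.elim_inl,
      Sum.elim_inr, Nat.add_eq_zero_iff, one_ne_zero, and_false, if_false]
    rw [mul_assoc, ← Finset.prod_mul_distrib]
    congr 1
    · apply Finset.prod_congr rfl
      intro g _
      rw [e2 φ _ ⟨T.p g, T.p_mem g⟩ rfl, T.split_inl]
    · apply Finset.prod_congr rfl
      intro g _
      rw [e2 φ _ ⟨T.p g, T.p_mem' g⟩ rfl]
  rw [Finset.sum_congr rfl (fun φ _ => e3 φ), ← Finset.mul_sum]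
  congr 1
  rw [← T.prod_sph n (fun g => ∑ b, Q (v g) b * f b), Finset.prod_univ_sum]
  simp

lemma LTree.Z_zero (T : LTree X) (Q : A → A → ℝ) (f : A → ℝ) :
    T.Z Q 0 f = ∑ a, f a := by
  unfold LTree.Z
  have hl : ∀ g : T.ball 0, T.lev g = 0 := fun g => by
    have := (T.mem_ball _ _).1 g.2; omega
  let r : T.ball 0 := ⟨T.o, (T.mem_ball _ _).2 (by rw [(T.lev_o T.o).2 rfl])⟩
  have : Unique (T.ball 0) := ⟨⟨r⟩, fun g => Subtype.ext ((T.lev_o _).1 (hl g))⟩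
  simp only [hl, if_true, Finset.prod_const_one, one_mul]
  rw [← Equiv.sum_comp (Equiv.funUnique (T.ball 0) A)]
  apply Finset.sum_congr rfl
  intro u _
  simp

/-- the recursion for partition functions -/
noncomputable def W (Q : A → A → ℝ) (k : ℕ) : ℕ → A → ℝ
  | 0, _ => 1
  | n+1, a => ∑ b, Q a b * W Q k n b ^ k

lemma LTree.Z_W (T : LTree X) (Q : A → A → ℝ) (k : ℕ) (h0 : T.kap 0 = k+1)
    (hk : ∀ n, T.kap (n+1) = k) (n m : ℕ) :
    T.Z Q (n+1) (fun a => W Q k m a ^ k) = ∑ a, W Q k (n+1+m) a ^ (k+1) := by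
  induction n generalizing m with
  | zero =>
    rw [T.Z_succ, T.Z_zero, h0]
    rw [show 0+1+m = m+1 by ring]; rfl
  | succ n ih =>
    rw [T.Z_succ, hk, show n+1+1+m = n+1+(m+1) by ring, ← ih]; rfl

lemma LTree.Z_one (T : LTree X) (Q : A → A → ℝ) (k : ℕ) (h0 : T.kap 0 = k+1)
    (hk : ∀ n, T.kap (n+1) = k) (n : ℕ) :
    T.Z Q n (fun _ => 1) = ∑ a, W Q k n a ^ (k+1) := by
  cases n with
  | zero => rw [T.Z_zero]; simp [W]
  | succ n =>
    have := T.Z_W Q k h0 hk n 0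
    simpa [W] using this

lemma W_one (k n : ℕ) (a : Bool) :
    W (fun _ _ : Bool => (1:ℝ)) k n a = 2 ^ (∑ i ∈ Finset.range n, k ^ i) := by
  induction n generalizing a with
  | zero => simp [W]
  | succ n ih =>
    simp only [W, ih]
    simp only [one_mul, Finset.sum_const, Finset.card_univ, Fintype.card_bool, nsmul_eq_mul]
    rw [Finset.sum_range_succ', ← pow_mul, Finset.sum_mul, pow_zero, pow_succ]
    simp only [pow_succ]
    push_cast; ring

lemma LTree.card_ball (T : LTree X) (k : ℕ) (h0 : T.kap 0 = k+1)
    (hk : ∀ n, T.kap (n+1) = k) (n : ℕ) :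
    (T.ball n).card = 1 + (k+1) * ∑ i ∈ Finset.range n, k ^ i := by
  have h := T.Z_one (fun _ _ : Bool => (1:ℝ)) k h0 hk n
  simp only [W_one] at h
  unfold LTree.Z at h
  simp at h
  have h2 : (2:ℝ) ^ (T.ball n).card = 2 ^ (1 + (k+1) * ∑ i ∈ Finset.range n, k ^ i) := by
    rw [h, pow_add, ← pow_mul]; ring
  have h3 : (2:ℕ) ^ (T.ball n).card = 2 ^ (1 + (k+1) * ∑ i ∈ Finset.range n, k ^ i) := by
    exact_mod_cast h2
  exact Nat.pow_right_injective le_rfl h3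

end tree

end FMS
namespace FMS

open FreeGroup

lemma ball_finite (d n : ℕ) : (freeBall d n).Finite := by
  have h := (List.finite_length_le (Fin d × Bool) n).preimage
    (f := (toWord : FreeGroup (Fin d) → _)) (toWord_injective.injOn)
  exact h

/-- the Cayley tree -/
noncomputable def freeTree (d : ℕ) : LTree (FreeGroup (Fin d)) where
  p := par
  lev := FreeGroup.norm
  o := 1
  ball n := (ball_finite d n).toFinset
  kap n := if n = 0 then 2 * d else 2 * d - 1
  lev_o g := by simp
  lev_p g := norm_par g
  mem_ball n g := by simp [freeBall]
  ch g := children g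

lemma card_freeBall (d : ℕ) (hd : 1 ≤ d) (n : ℕ) : Nat.card (freeBall d n) =
    1 + (2 * d - 1 + 1) * ∑ i ∈ Finset.range n, (2 * d - 1) ^ i := by
  rw [← (freeTree d).card_ball (2 * d - 1) (by simp [freeTree]; omega) (by simp [freeTree])]
  rw [Nat.card_coe_set_eq, Set.ncard_eq_toFinset_card _ (ball_finite d n)]
  rfl

/-- support matrix -/
noncomputable def supp {A : Type*} (E : Matrix A A ℝ) (a b : A) : ℝ :=
  open Classical in if 0 < E a b then 1 else 0

lemma exists_nbr {A : Type*} [Fintype A] (E : Matrix A A ℝ) (hE : AssumptionA E) (a : A) :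
    ∃ b, 0 < E a b := by
  by_contra! h
  have := hE.2.2 a
  have h2 : ∑ b, E a b ≤ 0 := Finset.sum_nonpos (fun b _ => h b)
  linarith

lemma par_mem {d n : ℕ} (g : freeBall d n) : par (g : FreeGroup (Fin d)) ∈ freeBall d n := by
  have := g.2
  simp only [freeBall, Set.mem_ofPred_eq] at this ⊢
  rw [norm_par]; omega

lemma mem_freeBlocks {A : Type*} [Fintype A] [Nonempty A] (E : Matrix A A ℝ)
    (hE : AssumptionA E) (hsym : ∀ a b, E a b = E b a) (d n : ℕ) (u : freeBall d n → A) :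
    u ∈ freeBlocks d E n ↔ ∀ g : freeBall d n, FreeGroup.norm (g : FreeGroup (Fin d)) ≠ 0 →
      0 < E (u ⟨par g, par_mem g⟩) (u g) := by
  classical
  constructor
  · rintro ⟨x, hx, hu⟩ g hg
    rw [hu, hu]
    have hg1 : (g : FreeGroup (Fin d)) ≠ 1 := by simpa using hg
    obtain ⟨⟨i, b⟩, hs⟩ := exists_par (g : FreeGroup (Fin d)) hg1
    simp only
    cases b with
    | true =>
      have h1 := hx (g : FreeGroup (Fin d)) i
      have : (of i : FreeGroup (Fin d)) = mk [(i, true)] := rfl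
      rw [this, hs] at h1
      exact h1
    | false =>
      have h1 := hx (par (g : FreeGroup (Fin d))) i
      have : (mk [(i, false)] : FreeGroup (Fin d)) = (of i)⁻¹ := by
        simp [of, invRev]
      rw [← hs, this, inv_mul_cancel_right] at h1
      rw [← hs, this, hsym]
      exact h1
  · intro h
    choose φ hφ using exists_nbr E hE
    let u' : FreeGroup (Fin d) → A := fun g =>
      if hg : g ∈ freeBall d n then u ⟨g, hg⟩ else Classical.arbitrary A
    let x : FreeGroup (Fin d) → A := fun g =>
      φ^[FreeGroup.norm g - n] (u' (par^[FreeGroup.norm g - n] g))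
    have hxu : ∀ g (hg : g ∈ freeBall d n), x g = u ⟨g, hg⟩ := by
      intro g hg
      have h1 : FreeGroup.norm g - n = 0 := by
        have h2 : FreeGroup.norm g ≤ n := hg
        omega
      simp only [x, h1, Function.iterate_zero, id_eq, u', hg, dif_pos]
    have key : ∀ g : FreeGroup (Fin d), FreeGroup.norm g ≠ 0 → 0 < E (x (par g)) (x g) := by
      intro g hg
      by_cases hgn : FreeGroup.norm g ≤ n
      · have h2 : g ∈ freeBall d n := hgn
        rw [hxu g h2, hxu (par g) (par_mem ⟨g, h2⟩)]
        exact h ⟨g, h2⟩ hg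
      · have h3 : FreeGroup.norm g - n = (FreeGroup.norm (par g) - n) + 1 := by
          rw [norm_par]; omega
        have h4 : x g = φ (x (par g)) := by
          simp only [x]
          rw [h3, Function.iterate_succ_apply', Function.iterate_succ_apply]
        rw [h4]
        exact hφ _
    refine ⟨x, ?_, fun g => (hxu g g.2).symm⟩
    intro g i
    rcases edge_cases g i with ⟨h1, h2⟩ | ⟨h1, h2⟩
    · have := key (g * of i) (by omega)
      rw [h1] at this
      rw [hsym]; exact this
    · have := key g (by simpa using h1)
      rwa [h2] at this

lemma card_freeBlocks {A : Type*} [Fintype A] [Nonempty A] (E : Matrix A A ℝ)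
    (hE : AssumptionA E) (hsym : ∀ a b, E a b = E b a) (d : ℕ) (hd : 1 ≤ d) (n : ℕ) :
    (Nat.card (freeBlocks d E n) : ℝ) = ∑ a, W (supp E) (2 * d - 1) n a ^ (2 * d - 1 + 1) := by
  classical
  rw [← (freeTree d).Z_one (supp E) (2 * d - 1) (by simp [freeTree]; omega) (by simp [freeTree])]
  let e : freeBall d n ≃ (freeTree d).ball n :=
    Equiv.subtypeEquivRight (fun g => by rw [(freeTree d).mem_ball]; rfl)
  have h1 : Nat.card (freeBlocks d E n) = Nat.card {u : (freeTree d).ball n → A //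
      ∀ g : (freeTree d).ball n, (freeTree d).lev g = 0 ∨
        0 < E (u ⟨(freeTree d).p g, (freeTree d).p_mem g⟩) (u g)} := by
    apply Nat.card_congr
    apply Equiv.subtypeEquiv (Equiv.arrowCongr e (Equiv.refl A))
    intro u
    rw [mem_freeBlocks E hE hsym]
    rw [← e.forall_congr_right]
    apply forall_congr'
    intro g
    rw [← or_iff_not_imp_left]
    simp only [Equiv.arrowCongr_apply, Equiv.coe_refl, Function.comp, id, Equiv.symm_apply_apply]
    rfl
  rw [h1, Nat.card_eq_fintype_card, Fintype.card_subtype]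
  unfold LTree.Z
  rw [Finset.card_filter]
  push_cast
  refine Finset.sum_congr (Finset.ext (by simp)) ?_
  intro u _
  have h2 : ∀ g : (freeTree d).ball n, (if (freeTree d).lev g = 0 then (1:ℝ) else
      supp E (u ⟨(freeTree d).p g, (freeTree d).p_mem g⟩) (u g)) =
      if ((freeTree d).lev g = 0 ∨
        0 < E (u ⟨(freeTree d).p g, (freeTree d).p_mem g⟩) (u g)) then 1 else 0 := by
    intro g
    clear h1
    unfold supp
    by_cases c1 : (freeTree d).lev g = 0
    · simp [c1]
    · simp only [c1, if_false, false_or]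
  simp only [h2, Finset.prod_boole, ite_self, Finset.prod_const_one, mul_one]
  simp

end FMS
namespace FMS

section analysis

variable {A : Type*} [Fintype A] {Q : A → A → ℝ}

/-- nonnegative matrix with an entry at least one in each row -/
def Good (Q : A → A → ℝ) : Prop := (∀ a b, 0 ≤ Q a b) ∧ ∀ a, ∃ b, 1 ≤ Q a b

lemma one_le_W (hQ : Good Q) (k n : ℕ) (a : A) : 1 ≤ W Q k n a := by
  induction n generalizing a with
  | zero => simp [W]
  | succ n ih =>
    obtain ⟨b, hb⟩ := hQ.2 a
    simp only [W]
    calc (1:ℝ) ≤ Q a b * W Q k n b ^ k := one_le_mul_of_one_le_of_one_le hb (one_le_pow₀ (ih b))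
      _ ≤ _ := Finset.single_le_sum (f := fun b => Q a b * W Q k n b ^ k)
        (fun b _ => mul_nonneg (hQ.1 a b) (pow_nonneg (zero_le_one.trans (ih b)) k))
        (Finset.mem_univ b)

/-- log of the partition function -/
noncomputable def ell (Q : A → A → ℝ) (k n : ℕ) (a : A) : ℝ := Real.log (W Q k n a)

lemma ell_nonneg (hQ : Good Q) (k n : ℕ) (a : A) : 0 ≤ ell Q k n a :=
  Real.log_nonneg (one_le_W hQ k n a)

lemma gibbs (hQ : Good Q) (k n : ℕ) (a : A) :
    ∃ P : A → ℝ, (∀ b, 0 ≤ P b) ∧ ∑ b, P b = 1 ∧ ∀ j m : ℕ,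
      ell Q k (n+1) a + ∑ b, P b * (j * ell Q j m b - k * ell Q k n b) ≤ ell Q j (m+1) a := by
  have hW : ∀ k n a, 0 < W Q k n a := fun k n a => zero_lt_one.trans_le (one_le_W hQ k n a)
  set w := W Q k (n+1) a with hw
  have hw0 : 0 < w := hW _ _ _
  have hsum : ∑ b, Q a b * W Q k n b ^ k / w = 1 := by
    rw [← Finset.sum_div]
    exact div_self hw0.ne'
  have hP : ∀ b, 0 ≤ Q a b * W Q k n b ^ k / w := fun b =>
    div_nonneg (mul_nonneg (hQ.1 a b) (pow_nonneg (hW _ _ _).le _)) hw0.le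
  refine ⟨fun b => Q a b * W Q k n b ^ k / w, hP, hsum, ?_⟩
  intro j m
  set y : A → ℝ := fun b => j * ell Q j m b - k * ell Q k n b with hy
  set μ : ℝ := ∑ b, Q a b * W Q k n b ^ k / w * y b with hμ
  change ell Q k (n+1) a + μ ≤ _
  have h1 : ∀ b, Q a b * W Q j m b ^ j = w * (Q a b * W Q k n b ^ k / w * Real.exp (y b)) := by
    intro b
    have e1 : ∀ j m, Real.exp (j * ell Q j m b) = W Q j m b ^ j := by
      intro j m
      rw [mul_comm, Real.exp_mul, ell, Real.exp_log (hW _ _ _), Real.rpow_natCast]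
    simp only [hy]
    rw [Real.exp_sub, e1, e1]
    have := (hW k n b).ne'
    field_simp
  have h2 : w * Real.exp μ ≤ W Q j (m+1) a := by
    simp only [W]
    rw [Finset.sum_congr rfl (fun b _ => h1 b), ← Finset.mul_sum]
    apply mul_le_mul_of_nonneg_left _ hw0.le
    calc Real.exp μ = ∑ b, Q a b * W Q k n b ^ k / w * (Real.exp μ * (1 + (y b - μ))) := by
          have : ∀ b, Q a b * W Q k n b ^ k / w * (Real.exp μ * (1 + (y b - μ))) =
            Real.exp μ * (1 - μ) * (Q a b * W Q k n b ^ k / w) +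
            Real.exp μ * (Q a b * W Q k n b ^ k / w * y b) := fun b => by ring
          rw [Finset.sum_congr rfl (fun b _ => this b), Finset.sum_add_distrib, ← Finset.mul_sum,
            ← Finset.mul_sum, hsum, ← hμ]
          ring
      _ ≤ _ := by
          apply Finset.sum_le_sum
          intro b _
          apply mul_le_mul_of_nonneg_left _ (hP b)
          have h3 : Real.exp (y b) = Real.exp μ * Real.exp (y b - μ) := by
            rw [← Real.exp_add]; ring_nf
          rw [h3]
          apply mul_le_mul_of_nonneg_left _ (Real.exp_pos _).le
          have := Real.add_one_le_exp (y b - μ)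
          linarith
  have h3 := Real.log_le_log (mul_pos hw0 (Real.exp_pos _)) h2
  rw [Real.log_mul hw0.ne' (Real.exp_pos _).ne', Real.log_exp] at h3
  exact h3

lemma ell_compare (hQ : Good Q) (k k' : ℕ) (hk : 1 ≤ k) (hkk : k ≤ k') (n : ℕ) (a : A) :
    ell Q k (n+1) a + ((k':ℝ)/k - 1) * ∑ j ∈ Finset.range n, ((k':ℝ)/k)^j *
      (ell Q k (n+1) a - ell Q k (j+1) a) ≤ ell Q k' (n+1) a := by
  have hk0 : (0:ℝ) < k := by exact_mod_cast hk
  set r : ℝ := (k':ℝ)/k with hr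
  have hr1 : 1 ≤ r := by
    rw [hr, le_div_iff₀ hk0, one_mul]; exact_mod_cast hkk
  have hk' : (k':ℝ) = r * k := by rw [hr]; field_simp
  induction n generalizing a with
  | zero => simp [ell, W]
  | succ n ih =>
    obtain ⟨P, hP, hP1, hG⟩ := gibbs hQ k (n+1) a
    have split : ∀ j m, ∑ b, P b * ((j:ℕ) * ell Q j m b - k * ell Q k (n+1) b) =
        j * ∑ b, P b * ell Q j m b - k * ∑ b, P b * ell Q k (n+1) b := by
      intro j m
      rw [Finset.mul_sum, Finset.mul_sum, ← Finset.sum_sub_distrib]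
      exact Finset.sum_congr rfl (fun b _ => by ring)
    have g1 := hG k' (n+1)
    rw [split] at g1
    have g2 : ∀ m, ell Q k (n+1+1) a - ell Q k (m+1) a ≤
        k * (∑ b, P b * ell Q k (n+1) b - ∑ b, P b * ell Q k m b) := by
      intro m
      have := hG k m
      rw [split] at this
      linarith
    have g3 : ∑ b, P b * ell Q k (n+1) b + (r - 1) * ∑ j ∈ Finset.range n, r^j *
      (∑ b, P b * ell Q k (n+1) b - ∑ b, P b * ell Q k (j+1) b) ≤
        ∑ b, P b * ell Q k' (n+1) b := by
      have h1 := Finset.sum_le_sum (s := Finset.univ)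
        (fun b _ => mul_le_mul_of_nonneg_left (ih b) (hP b))
      refine le_trans (le_of_eq ?_) h1
      simp only [mul_add, Finset.sum_add_distrib]
      congr 1
      simp only [← Finset.sum_sub_distrib, Finset.mul_sum]
      rw [Finset.sum_comm]
      refine Finset.sum_congr rfl (fun b _ => Finset.sum_congr rfl (fun j _ => by ring))
    set p : ℕ → ℝ := fun m => ∑ b, P b * ell Q k m b with hp
    set p' := ∑ b, P b * ell Q k' (n+1) b with hp'
    have g2' : ∀ m, ell Q k (n+1+1) a - ell Q k (m+1) a ≤ k * (p (n+1) - p m) := g2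
    have g3' : p (n+1) + (r-1) * ∑ j ∈ Finset.range n, r^j * (p (n+1) - p (j+1)) ≤ p' := g3
    have g1' : ell Q k (n+1+1) a + (k' * p' - k * p (n+1)) ≤ ell Q k' (n+1+1) a := g1
    have p0 : p 0 = 0 := by simp [hp, ell, W]
    rw [Finset.sum_range_succ']
    have g4 : ∑ j ∈ Finset.range n, r^(j+1) * (ell Q k (n+1+1) a - ell Q k (j+1+1) a) ≤
        r * k * ∑ j ∈ Finset.range n, r^j * (p (n+1) - p (j+1)) := by
      rw [Finset.mul_sum]
      apply Finset.sum_le_sum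
      intro j _
      calc _ ≤ r^(j+1) * (k * (p (n+1) - p (j+1))) :=
            mul_le_mul_of_nonneg_left (g2' _) (by positivity)
        _ = _ := by ring
    have g5 := g2' 0
    rw [p0] at g5
    have g6 : r * k * (p (n+1) + (r-1) * ∑ j ∈ Finset.range n, r^j * (p (n+1) - p (j+1)))
      ≤ r * k * p' := mul_le_mul_of_nonneg_left g3' (by positivity)
    have g7 := mul_le_mul_of_nonneg_left (add_le_add g4 g5) (sub_nonneg.2 hr1)
    rw [hk'] at g1'
    simp only [pow_zero, one_mul]
    refine le_trans ?_ g1'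
    linarith

variable [Nonempty A]

/-- maximum of the log partition function -/
noncomputable def LL (Q : A → A → ℝ) (k n : ℕ) : ℝ :=
  Finset.univ.sup' Finset.univ_nonempty (ell Q k n)

lemma ell_le_LL (k n : ℕ) (a : A) : ell Q k n a ≤ LL Q k n :=
  Finset.le_sup' (ell Q k n) (Finset.mem_univ a)

lemma exists_LL (k n : ℕ) : ∃ a, LL Q k n = ell Q k n a := by
  obtain ⟨a, _, h⟩ := Finset.exists_mem_eq_sup' (Finset.univ_nonempty (α := A)) (ell Q k n)
  exact ⟨a, h⟩

lemma LL_nonneg (hQ : Good Q) (k n : ℕ) : 0 ≤ LL Q k n := by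
  obtain ⟨a, h⟩ := exists_LL (Q := Q) k n
  rw [h]; exact ell_nonneg hQ k n a

lemma LL_compare (hQ : Good Q) (k k' : ℕ) (hk : 1 ≤ k) (hkk : k ≤ k') (n : ℕ) :
    LL Q k (n+1) + ((k':ℝ)/k - 1) * ∑ j ∈ Finset.range n, ((k':ℝ)/k)^j *
      (LL Q k (n+1) - LL Q k (j+1)) ≤ LL Q k' (n+1) := by
  obtain ⟨a, ha⟩ := exists_LL (Q := Q) k (n+1)
  refine le_trans ?_ ((ell_compare hQ k k' hk hkk n a).trans (ell_le_LL _ _ a))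
  have hk0 : (0:ℝ) < k := by exact_mod_cast hk
  have hr1 : 1 ≤ (k':ℝ)/k := by
    rw [le_div_iff₀ hk0, one_mul]; exact_mod_cast hkk
  rw [ha]
  have hell : ∑ j ∈ Finset.range n, ((k':ℝ)/k)^j * (ell Q k (n+1) a - LL Q k (j+1)) ≤
      ∑ j ∈ Finset.range n, ((k':ℝ)/k)^j * (ell Q k (n+1) a - ell Q k (j+1) a) := by
    apply Finset.sum_le_sum
    intro j _
    apply mul_le_mul_of_nonneg_left _ (by positivity)
    linarith [ell_le_LL (Q := Q) k (j+1) a]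
  have := mul_le_mul_of_nonneg_left hell (sub_nonneg.2 hr1)
  linarith

lemma W_add_le (hQ : Good Q) (k m i : ℕ) (a : A) :
    W Q k (i+m) a ≤ W Q k i a * Real.exp (LL Q k m) ^ (k^i) := by
  have hW : ∀ k n a, 0 < W Q k n a := fun k n a => zero_lt_one.trans_le (one_le_W hQ k n a)
  induction i generalizing a with
  | zero =>
    simp only [W, pow_zero, pow_one, one_mul, zero_add]
    rw [← Real.log_le_iff_le_exp (hW _ _ _)]
    exact ell_le_LL k m a
  | succ i ih =>
    rw [show i+1+m = (i+m)+1 by ring]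
    simp only [W]
    rw [Finset.sum_mul]
    apply Finset.sum_le_sum
    intro b _
    rw [mul_assoc]
    apply mul_le_mul_of_nonneg_left _ (hQ.1 a b)
    rw [pow_succ k i, pow_mul, ← mul_pow]
    exact pow_le_pow_left₀ (hW _ _ _).le (ih b) k

lemma LL_add_le (hQ : Good Q) (k i m : ℕ) :
    LL Q k (i+m) ≤ LL Q k i + (k:ℝ)^i * LL Q k m := by
  have hW : ∀ k n a, 0 < W Q k n a := fun k n a => zero_lt_one.trans_le (one_le_W hQ k n a)
  obtain ⟨a, ha⟩ := exists_LL (Q := Q) k (i+m)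
  rw [ha]
  have h := Real.log_le_log (hW _ _ _) (W_add_le hQ k m i a)
  rw [Real.log_mul (hW _ _ _).ne' (by positivity), Real.log_pow, Real.log_exp] at h
  push_cast at h
  have := ell_le_LL (Q := Q) k i a
  unfold ell at *
  linarith

/-- geometric size -/
noncomputable def ss (k n : ℕ) : ℝ := ∑ i ∈ Finset.range n, (k:ℝ)^i

lemma ss_succ (k n : ℕ) : ss k (n+1) = ss k n + (k:ℝ)^n := Finset.sum_range_succ _ _

lemma ss_ge (k n : ℕ) (hk : 1 ≤ k) : (n:ℝ) ≤ ss k n := by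
  have hk0 : (1:ℝ) ≤ k := by exact_mod_cast hk
  induction n with
  | zero => simp [ss]
  | succ n ih =>
    rw [ss_succ]; push_cast
    have := one_le_pow₀ (n := n) hk0
    linarith

lemma ss_tendsto (k : ℕ) (hk : 1 ≤ k) : Tendsto (ss k) atTop atTop :=
  tendsto_atTop_mono (fun n => ss_ge k n hk) tendsto_natCast_atTop_atTop

lemma limit_exists (hQ : Good Q) (k : ℕ) (hk : 1 ≤ k) :
    ∃ h, Tendsto (fun n => LL Q k n / ss k n) atTop (𝓝 h) := by
  rcases eq_or_lt_of_le hk with h1 | h2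
  · subst h1
    have hsub : Subadditive (LL Q 1) := fun m n => by
      have := LL_add_le hQ 1 m n
      simpa using this
    refine ⟨hsub.lim, ?_⟩
    have := hsub.tendsto_lim ⟨0, by
      rintro _ ⟨n, rfl⟩
      exact div_nonneg (LL_nonneg hQ 1 n) (Nat.cast_nonneg n)⟩
    refine this.congr (fun n => ?_)
    simp [ss]
  · have hk1 : (1:ℝ) < k := by exact_mod_cast h2
    have hkm : (0:ℝ) < k - 1 := by linarith
    set c := LL Q k 1 / ((k:ℝ) - 1) with hc
    have hc0 : 0 ≤ c := div_nonneg (LL_nonneg hQ k 1) hkm.le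
    have hc1 : LL Q k 1 = c * (k - 1) := by rw [hc]; field_simp
    have hanti : Antitone (fun n => (LL Q k n + c) / (k:ℝ)^n) := by
      apply antitone_nat_of_succ_le
      intro n
      have := LL_add_le hQ k 1 n
      rw [add_comm 1 n, pow_one] at this
      rw [div_le_div_iff₀ (by positivity) (by positivity), pow_succ]
      have h3 : LL Q k (n+1) + c ≤ (LL Q k n + c) * k := by nlinarith
      calc _ ≤ (LL Q k n + c) * k * (k:ℝ)^n := mul_le_mul_of_nonneg_right h3 (by positivity)
        _ = _ := by ring
    have hb : BddBelow (Set.range (fun n => (LL Q k n + c) / (k:ℝ)^n)) := ⟨0, by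
      rintro _ ⟨n, rfl⟩
      have := LL_nonneg hQ k n
      positivity⟩
    have ht := tendsto_atTop_ciInf hanti hb
    have hinv : Tendsto (fun n : ℕ => ((k:ℝ)^n)⁻¹) atTop (𝓝 0) :=
      tendsto_inv_atTop_zero.comp (tendsto_pow_atTop_atTop_of_one_lt hk1)
    have h4 := ((ht.sub (hinv.const_mul c)).mul_const ((k:ℝ)-1)).div
      ((tendsto_const_nhds (x := (1:ℝ))).sub hinv) (by norm_num)
    refine ⟨_, h4.congr (fun n => ?_)⟩
    have hs : ss k n = ((k:ℝ)^n - 1) / (k - 1) := geom_sum_eq hk1.ne' n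
    rw [hs]
    have hkn : (k:ℝ)^n ≠ 0 := by positivity
    rcases Nat.eq_zero_or_pos n with rfl | hn
    · simp
    have h5 : (k:ℝ)^n - 1 ≠ 0 := by
      have := one_lt_pow₀ hk1 hn.ne'
      linarith
    simp only [Pi.div_apply]
    field_simp
    ring

lemma ss_double (k n : ℕ) : ss k (n+n) = (1 + (k:ℝ)^n) * ss k n := by
  unfold ss
  rw [Finset.sum_range_add]
  simp only [pow_add, ← Finset.mul_sum]
  ring

lemma limit_le (hQ : Good Q) (k : ℕ) (hk : 1 ≤ k) (h : ℝ)
    (hl : Tendsto (fun n => LL Q k n / ss k n) atTop (𝓝 h)) (n : ℕ) :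
    h * ss k n ≤ LL Q k n := by
  rcases Nat.eq_zero_or_pos n with rfl | hn
  · simp [ss, LL_nonneg hQ k 0]
  have hs : ∀ n, 0 < n → 0 < ss k n := fun n hn =>
    lt_of_lt_of_le (by exact_mod_cast hn) (ss_ge k n hk)
  have step : ∀ n, 0 < n → LL Q k (n+n) / ss k (n+n) ≤ LL Q k n / ss k n := by
    intro n hn
    rw [div_le_div_iff₀ (hs _ (by omega)) (hs _ hn), ss_double]
    have := LL_add_le hQ k n n
    calc _ ≤ (LL Q k n + (k:ℝ)^n * LL Q k n) * ss k n :=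
          mul_le_mul_of_nonneg_right this (hs n hn).le
      _ = _ := by ring
  have iter : ∀ j, LL Q k (2^j * n) / ss k (2^j*n) ≤ LL Q k n / ss k n := by
    intro j
    induction j with
    | zero => simp
    | succ j ih =>
      rw [pow_succ, show 2^j*2*n = 2^j*n + 2^j*n by ring]
      exact (step _ (by positivity)).trans ih
  have htt : Tendsto (fun j : ℕ => 2^j * n) atTop atTop := by
    apply Filter.Tendsto.atTop_mul_const' hn
    exact tendsto_pow_atTop_atTop_of_one_lt (by norm_num)
  have := le_of_tendsto' (hl.comp htt) iter
  rwa [le_div_iff₀ (hs n hn)] at this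

lemma limit_mono (hQ : Good Q) (k k' : ℕ) (hk : 1 ≤ k) (hkk : k ≤ k') (h h' : ℝ)
    (hl : Tendsto (fun n => LL Q k n / ss k n) atTop (𝓝 h))
    (hl' : Tendsto (fun n => LL Q k' n / ss k' n) atTop (𝓝 h')) : h ≤ h' := by
  by_contra! hlt
  obtain ⟨c, hc1, hc2⟩ := exists_between hlt
  have hk0 : (0:ℝ) < k := by exact_mod_cast hk
  have hk1 : (1:ℝ) ≤ k := by exact_mod_cast hk
  have hcmp := LL_compare hQ k k' hk hkk
  set r : ℝ := (k':ℝ)/k with hr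
  have hr1 : 1 ≤ r := by
    rw [hr, le_div_iff₀ hk0, one_mul]; exact_mod_cast hkk
  have hr0 : 0 < r := by linarith
  have hk' : (k':ℝ) = r * k := by rw [hr]; field_simp
  have hgeo : ∀ n, (r - 1) * ∑ j ∈ Finset.range n, r^j = r^n - 1 := fun n => mul_geom_sum r n
  have hcmp' : ∀ n, r^n * LL Q k (n+1) - (r-1) * ∑ j ∈ Finset.range n, r^j * LL Q k (j+1) ≤
      LL Q k' (n+1) := by
    intro n
    refine le_trans (le_of_eq ?_) (hcmp n)
    simp only [mul_sub, Finset.sum_sub_distrib, ← Finset.sum_mul]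
    have := hgeo n
    linear_combination (-LL Q k (n+1)) * this
  have hss : ∀ n, ss k' (n+1) = r^n * ss k (n+1) - (r-1) * ∑ j ∈ Finset.range n, r^j * ss k (j+1) := by
    intro n
    induction n with
    | zero => simp [ss]
    | succ n ih =>
      rw [ss_succ, ih, Finset.sum_range_succ, ss_succ k (n+1), hk']
      ring
  set e : ℕ → ℝ := fun n => LL Q k n - h * ss k n with he
  have he0 : ∀ n, 0 ≤ e n := fun n => sub_nonneg.2 (limit_le hQ k hk h hl n)
  set q : ℕ → ℝ := fun n => (∑ j ∈ Finset.range n, r^j * e (j+1)) / r^n with hq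
  have hq0 : ∀ n, 0 ≤ q n := fun n => div_nonneg
    (Finset.sum_nonneg (fun j _ => mul_nonneg (by positivity) (he0 _))) (by positivity)
  set δ := (h - c) / r with hδ
  have hδ0 : 0 < δ := div_pos (by linarith) hr0
  have hev : ∀ᶠ n in atTop, q (n+1) ≤ q n - δ := by
    have h1 := (tendsto_add_atTop_iff_nat 1).2 hl'
    filter_upwards [h1.eventually (gt_mem_nhds hc1)] with n hn
    have hs : (n:ℝ) + 1 ≤ ss k' (n+1) := by
      have := ss_ge k' (n+1) (hk.trans hkk)
      push_cast at this; exact this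
    have hs0 : 0 < ss k' (n+1) := by
      have : (0:ℝ) ≤ n := Nat.cast_nonneg n
      linarith
    rw [div_lt_iff₀ hs0] at hn
    have h2 := hcmp' n
    have h3 := hss n
    have h4 : ∑ j ∈ Finset.range n, r^j * e (j+1) =
        ∑ j ∈ Finset.range n, r^j * LL Q k (j+1) - h * ∑ j ∈ Finset.range n, r^j * ss k (j+1) := by
      rw [Finset.mul_sum, ← Finset.sum_sub_distrib]
      exact Finset.sum_congr rfl (fun j _ => by simp only [he]; ring)
    have h5 : r^n ≤ ss k' (n+1) := by
      rw [ss_succ, hk', mul_pow]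
      have h6 : (0:ℝ) ≤ ss k' n := (Nat.cast_nonneg n).trans (ss_ge k' n (hk.trans hkk))
      have h7 := one_le_pow₀ (n := n) hk1
      have h8 : 0 < r^n := by positivity
      nlinarith
    have h9 : (h - c) * r^n ≤ (h - c) * ss k' (n+1) :=
      mul_le_mul_of_nonneg_left h5 (by linarith)
    simp only [hq, hδ]
    rw [Finset.sum_range_succ]
    rw [div_sub_div _ _ (by positivity) hr0.ne', div_le_div_iff₀ (by positivity) (by positivity)]
    have h10 : (∑ j ∈ Finset.range n, r^j * e (j+1)) + r^n * e (n+1) ≤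
      (∑ j ∈ Finset.range n, r^j * e (j+1)) * r - r^n * (h - c) := by
      have : e (n+1) = LL Q k (n+1) - h * ss k (n+1) := rfl
      rw [this, h4]
      have h11 := congrArg (fun z => h * z) h3
      linarith
    rw [pow_succ]
    exact mul_le_mul_of_nonneg_right h10 (by positivity)
  obtain ⟨N, hN⟩ := eventually_atTop.1 hev
  have hdec : ∀ m : ℕ, q (N+m) ≤ q N - m * δ := by
    intro m
    induction m with
    | zero => simp
    | succ m ih =>
      have := hN (N+m) (by omega)
      rw [← add_assoc]; push_cast
      linarith
  obtain ⟨m, hm⟩ := exists_nat_gt (q N / δ)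
  rw [div_lt_iff₀ hδ0] at hm
  have := hdec m
  have := hq0 (N+m)
  linarith

lemma log_sum_tendsto (hQ : Good Q) (k : ℕ) (hk : 1 ≤ k) (h : ℝ)
    (hl : Tendsto (fun n => LL Q k n / ss k n) atTop (𝓝 h)) :
    Tendsto (fun n => Real.log (∑ a, W Q k n a ^ (k+1)) / (1 + ((k:ℝ)+1) * ss k n)) atTop (𝓝 h) := by
  have hW : ∀ k n a, 0 < W Q k n a := fun k n a => zero_lt_one.trans_le (one_le_W hQ k n a)
  have hs0 : ∀ n, 0 ≤ ss k n := fun n => (Nat.cast_nonneg n).trans (ss_ge k n hk)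
  have hden : ∀ n, 0 < 1 + ((k:ℝ)+1) * ss k n := fun n => by
    have := hs0 n
    positivity
  have hdt : Tendsto (fun n => 1 + ((k:ℝ)+1) * ss k n) atTop atTop :=
    tendsto_atTop_add_const_left _ _ ((ss_tendsto k hk).const_mul_atTop (by positivity))
  have hinv := tendsto_inv_atTop_zero.comp hdt
  have lower : Tendsto (fun n => ((k:ℝ)+1) * LL Q k n / (1 + ((k:ℝ)+1) * ss k n)) atTop (𝓝 h) := by
    have h1 := hl.mul ((tendsto_const_nhds (x := (1:ℝ))).sub hinv)
    rw [sub_zero, mul_one] at h1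
    refine h1.congr' ?_
    filter_upwards [eventually_ge_atTop 1] with n hn
    have h2 : 0 < ss k n := lt_of_lt_of_le (by exact_mod_cast hn) (ss_ge k n hk)
    have h3 := (hden n).ne'
    simp only [Function.comp]
    field_simp
    ring
  have upper : Tendsto (fun n => (Real.log (Fintype.card A) + ((k:ℝ)+1) * LL Q k n) /
      (1 + ((k:ℝ)+1) * ss k n)) atTop (𝓝 h) := by
    have h1 := (hinv.const_mul (Real.log (Fintype.card A))).add lower
    rw [mul_zero, zero_add] at h1
    refine h1.congr (fun n => ?_)
    simp only [Function.comp]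
    rw [add_div, ← div_eq_mul_inv]
  refine tendsto_of_tendsto_of_tendsto_of_le_of_le lower upper ?_ ?_
  · intro n
    apply div_le_div_of_nonneg_right _ (hden n).le
    obtain ⟨a, ha⟩ := exists_LL (Q := Q) k n
    have h1 : W Q k n a ^ (k+1) ≤ ∑ a, W Q k n a ^ (k+1) :=
      Finset.single_le_sum (f := fun a => W Q k n a ^ (k+1))
        (fun b _ => pow_nonneg (hW k n b).le _) (Finset.mem_univ a)
    have h2 := Real.log_le_log (pow_pos (hW k n a) _) h1
    rw [Real.log_pow] at h2
    push_cast at h2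
    rw [ha]; exact h2
  · intro n
    apply div_le_div_of_nonneg_right _ (hden n).le
    have h1 : ∑ a, W Q k n a ^ (k+1) ≤ (Fintype.card A : ℝ) * Real.exp (LL Q k n) ^ (k+1) := by
      calc _ ≤ ∑ _a : A, Real.exp (LL Q k n) ^ (k+1) := by
            apply Finset.sum_le_sum
            intro a _
            apply pow_le_pow_left₀ (hW k n a).le
            rw [← Real.log_le_iff_le_exp (hW _ _ _)]
            exact ell_le_LL k n a
        _ = _ := by simp
    have h2 := Real.log_le_log
      (Finset.sum_pos (fun a _ => pow_pos (hW k n a) (k+1)) Finset.univ_nonempty) h1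
    have hA : (Fintype.card A : ℝ) ≠ 0 := by exact_mod_cast Fintype.card_ne_zero
    rw [Real.log_mul hA (by positivity), Real.log_pow, Real.log_exp] at h2
    push_cast at h2
    exact h2

end analysis

end FMS
namespace FMS

lemma good_supp {A : Type*} [Fintype A] (E : Matrix A A ℝ) (hE : AssumptionA E) :
    Good (supp E) := by
  constructor
  · intro a b
    unfold supp; split_ifs <;> norm_num
  · intro a
    obtain ⟨b, hb⟩ := exists_nbr E hE a
    exact ⟨b, by simp [supp, hb]⟩

end FMS

/-- for symmetric `E`, the entropy
`h(Y^{(d)}_E) = lim_n log |B_n-blocks| / |B_n|` exists for every `d ≥ 1` and is monotone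
increasing in `d`. -/
theorem stmt4 {A : Type*} [Fintype A] [Nonempty A] (E : Matrix A A ℝ)
    (hE : AssumptionA E) (hsym : ∀ a b, E a b = E b a) :
    ∃ h : ℕ → ℝ,
      (∀ d : ℕ, 1 ≤ d →
        Tendsto (fun n : ℕ =>
            Real.log (Nat.card (freeBlocks d E n)) / (Nat.card (freeBall d n) : ℝ))
          atTop (nhds (h d))) ∧
      ∀ d₁ d₂ : ℕ, 1 ≤ d₁ → d₁ ≤ d₂ → h d₁ ≤ h d₂ := by
  have hQ := FMS.good_supp E hE
  have hex : ∀ d : ℕ, ∃ h : ℝ, 1 ≤ d → Tendsto (fun n =>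
      FMS.LL (FMS.supp E) (2 * d - 1) n / FMS.ss (2 * d - 1) n) atTop (𝓝 h) := by
    intro d
    by_cases hd : 1 ≤ d
    · obtain ⟨h, hh⟩ := FMS.limit_exists hQ (2 * d - 1) (by omega)
      exact ⟨h, fun _ => hh⟩
    · exact ⟨0, fun h => absurd h hd⟩
  choose h hh using hex
  refine ⟨h, ?_, ?_⟩
  · intro d hd
    refine (FMS.log_sum_tendsto hQ (2 * d - 1) (by omega) (h d) (hh d hd)).congr (fun n => ?_)
    rw [FMS.card_freeBlocks E hE hsym d hd n, FMS.card_freeBall d hd n]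
    unfold FMS.ss
    push_cast
    rfl
  · intro d₁ d₂ h1 h2
    exact FMS.limit_mono hQ (2 * d₁ - 1) (2 * d₂ - 1) (by omega) (by omega) _ _
      (hh d₁ h1) (hh d₂ (h1.trans h2))
end

section
/- For every integer d ≥ 2 and k ≥ 1: lim_{n→∞} sup_{(π,P)∈Γ'_k} inf{ d_{v,V}((π,P), (ṽ,M̃)) : (ṽ,M̃) a reversal of an element of Γ*_n^{n+k} } = 0. -/
open Filter Topology

/-- A probability vector indexed by the alphabet `A`. -/
def IsProbVec {A : Type*} [Fintype A] (π : A → ℝ) : Prop :=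
  (∀ a, 0 ≤ π a) ∧ ∑ a, π a = 1

/-- A column-stochastic matrix: nonnegative entries, each column sums to `1`. -/
def IsColStochastic {A : Type*} [Fintype A] (P : Matrix A A ℝ) : Prop :=
  (∀ a b, 0 ≤ P a b) ∧ ∀ b, ∑ a, P a b = 1

/-- The hom tree-shift `X_E^{×d}` on the rooted `d`-tree, whose vertices are the finite
words over `Fin d` (the empty word is the root, and the children of `g` are `g ++ [i]`). -/
def treeX {A : Type*} (d : ℕ) (E : Matrix A A ℝ) : Set (List (Fin d) → A) :=
  {t | ∀ g : List (Fin d), ∀ i : Fin d, 0 < E (t (g ++ [i])) (t g)}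

/-- The level-`n` distribution vector `π_n(t)`: frequencies of each symbol on level `n`. -/
noncomputable def pivec {A : Type*} (d n : ℕ) (t : List (Fin d) → A) : A → ℝ :=
  fun a => (Nat.card {g : List (Fin d) // g.length = n ∧ t g = a} : ℝ) / (d : ℝ) ^ n

/-- The transition matrix `Q_n(t)` from level `n` to level `n+1`: `Q_n(t)_{a,b}` is the
proportion of vertices labeled `a` among all children of level-`n` vertices labeled `b`,
and `E_{a,b}/Σ_c E_{c,b}` if no level-`n` vertex is labeled `b`. -/
noncomputable def Qmat {A : Type*} [Fintype A] (d : ℕ) (E : Matrix A A ℝ) (n : ℕ)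
    (t : List (Fin d) → A) : Matrix A A ℝ :=
  fun a b =>
    if Nat.card {g : List (Fin d) // g.length = n ∧ t g = b} = 0 then
      E a b / ∑ c, E c b
    else
      (Nat.card {p : List (Fin d) × Fin d //
          p.1.length = n ∧ t p.1 = b ∧ t (p.1 ++ [p.2]) = a} : ℝ) /
        ((d : ℝ) * (Nat.card {g : List (Fin d) // g.length = n ∧ t g = b} : ℝ))

/-- A pair `(v,Q)` is typical with respect to `E`. -/
def Typical {A : Type*} [Fintype A] (E : Matrix A A ℝ) (v : A → ℝ)
    (Q : Matrix A A ℝ) : Prop :=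
  (∀ a b, E a b = 0 → Q a b = 0) ∧ ∀ a b, v b = 0 → Q a b = E a b / ∑ c, E c b

/-- The variational distance `d_v(π,τ) = (1/2) Σ_a |π_a − τ_a|` between vectors. -/
noncomputable def dv {A : Type*} [Fintype A] (π τ : A → ℝ) : ℝ :=
  (∑ a, |π a - τ a|) / 2

/-- The variational distance `d_V(P,T) = max_b d_v(P·_b, T·_b)` between matrices. -/
noncomputable def dV {A : Type*} [Fintype A] (P T : Matrix A A ℝ) : ℝ :=
  ⨆ b, dv (fun a => P a b) (fun a => T a b)

/-- The distance `d_{v,V}` between tuples: the maximum over coordinates of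
`max(d_v, d_V)`. -/
noncomputable def tdist {A : Type*} [Fintype A] (k : ℕ) (π τ : Fin (k + 1) → A → ℝ)
    (P T : Fin k → Matrix A A ℝ) : ℝ :=
  max (⨆ i, dv (π i) (τ i)) (⨆ i, dV (P i) (T i))

/-- `(π,P) ∈ Γ'_k`: `π^{(k)}` is a standard unit vector, `π^{(j)} = P^{(j)} π^{(j+1)}`,
and every pair `(π^{(j+1)}, P^{(j)})` is typical. -/
def GammaPrime {A : Type*} [Fintype A] [DecidableEq A] (E : Matrix A A ℝ) (k : ℕ)
    (π : Fin (k + 1) → A → ℝ) (P : Fin k → Matrix A A ℝ) : Prop :=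
  (∀ i, IsProbVec (π i)) ∧ (∀ j, IsColStochastic (P j)) ∧
    (∃ a : A, π (Fin.last k) = Pi.single a 1) ∧
    (∀ j : Fin k, π j.castSucc = (P j).mulVec (π j.succ)) ∧
    ∀ j : Fin k, Typical E (π j.succ) (P j)

/-- `(τ,T)` is the reversal of an element of `Γ*_n^{n+k}`. -/
def IsReversal {A : Type*} [Fintype A] (d : ℕ) (E : Matrix A A ℝ) (n k : ℕ)
    (τ : Fin (k + 1) → A → ℝ) (T : Fin k → Matrix A A ℝ) : Prop :=
  ∃ t ∈ treeX d E, (∀ i : Fin (k + 1), τ i = pivec d (n + (k - (i : ℕ))) t) ∧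
    ∀ i : Fin k, T i = Qmat d E (n + (k - 1 - (i : ℕ))) t

lemma alloc_exists {A : Type*} [Fintype A] [DecidableEq A] (ε : ℝ) (hε : 0 < ε) (M : ℕ) :
    ∃ N0 : ℕ, ∀ N ≥ N0, ∀ p : A → ℝ, IsProbVec p → ∃ c : A → ℕ, ∑ a, c a = N ∧
      ∀ a, (p a = 0 → c a = 0) ∧ (0 < p a → M ≤ c a) ∧ |(c a : ℝ) - N * p a| ≤ ε * N := by
  set K : ℕ := Fintype.card A with hK
  set B : ℝ := M + (K + 1) * (K * M + 1) with hB
  refine ⟨K * M + ⌈B / ε⌉₊, fun N hN p hp => ?_⟩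
  have hN1 : K * M ≤ N := by omega
  have hN1r : (K : ℝ) * M ≤ N := by exact_mod_cast hN1
  have hN2 : B ≤ ε * N := by
    have h1 : B / ε ≤ N := (Nat.le_ceil _).trans (by exact_mod_cast (by omega))
    rw [div_le_iff₀ hε] at h1; linarith
  obtain ⟨hp0, hp1⟩ := hp
  have hple : ∀ a, p a ≤ 1 := fun a => by
    rw [← hp1]; exact Finset.single_le_sum (fun i _ => hp0 i) (Finset.mem_univ a)
  obtain ⟨a0, ha0⟩ : ∃ a, p a ≠ 0 := by
    by_contra! h
    simp [h] at hp1
  let c0 : A → ℕ := fun a => if p a = 0 then 0 else M + ⌊((N : ℝ) - K * M) * p a⌋₊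
  have hlow : ∀ a, (N : ℝ) * p a - (K * M + 1) ≤ c0 a := by
    intro a
    have hKM : (0 : ℝ) ≤ K * M := by positivity
    by_cases h : p a = 0
    · simp only [c0, h, if_true]; simp; linarith
    · simp only [c0, h, if_false]
      push_cast
      have := (Nat.lt_floor_add_one (((N : ℝ) - K * M) * p a))
      have h3 : (K : ℝ) * M * p a ≤ K * M := mul_le_of_le_one_right hKM (hple a)
      have : (0 : ℝ) ≤ M := by positivity
      nlinarith
  have hup : ∀ a, (c0 a : ℝ) ≤ M + ((N : ℝ) - K * M) * p a := by
    intro a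
    have hpos : 0 ≤ ((N : ℝ) - K * M) * p a := mul_nonneg (by linarith) (hp0 a)
    by_cases h : p a = 0
    · simp [c0, h]
    · simp only [c0, h, if_false]
      push_cast
      have := Nat.floor_le hpos
      linarith
  have hsumle : ∑ a, c0 a ≤ N := by
    have : ((∑ a, c0 a : ℕ) : ℝ) ≤ N := by
      push_cast
      refine (Finset.sum_le_sum fun a _ => hup a).trans ?_
      rw [Finset.sum_add_distrib, ← Finset.mul_sum, hp1]
      simp [← hK]
    exact_mod_cast this
  set R : ℕ := N - ∑ a, c0 a with hR
  have hRle : (R : ℝ) ≤ K * (K * M + 1) := by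
    have h1 : (R : ℝ) = N - ∑ a, (c0 a : ℝ) := by
      rw [hR, Nat.cast_sub hsumle]; push_cast; rfl
    have h2 := Finset.sum_le_sum (s := Finset.univ) fun a _ => hlow a
    rw [Finset.sum_sub_distrib, ← Finset.mul_sum, hp1] at h2
    simp [← hK] at h2
    linarith
  refine ⟨fun a => c0 a + if a = a0 then R else 0, ?_, fun a => ⟨?_, ?_, ?_⟩⟩
  · rw [Finset.sum_add_distrib]; simp; omega
  · intro h
    have : a ≠ a0 := by rintro rfl; exact ha0 h
    simp [c0, h, this]
  · intro h
    have := h.ne'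
    simp only [c0, this, if_false]
    omega
  · refine le_trans ?_ hN2
    have e : (((if a = a0 then R else 0 : ℕ)) : ℝ) ≤ K * (K * M + 1) := by
      split_ifs
      · exact hRle
      · simp; positivity
    have e0 : (0 : ℝ) ≤ ((if a = a0 then R else 0 : ℕ) : ℝ) := by positivity
    have h1 := hlow a
    have h2 := hup a
    have h3 : 0 ≤ (K : ℝ) * M * p a := mul_nonneg (by positivity) (hp0 a)
    have h4 : (0 : ℝ) ≤ K * (K * M + 1) := by positivity
    have h5 : (0 : ℝ) ≤ M := by positivity
    rw [Nat.cast_add, abs_le]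
    constructor <;> nlinarith

lemma fin_level (d n : ℕ) (q : List (Fin d) → Prop) :
    Finite {g : List (Fin d) // g.length = n ∧ q g} :=
  ((List.finite_length_eq (Fin d) n).subset (fun _ h => h.1)).to_subtype

lemma fin_pairs (d n : ℕ) (q : List (Fin d) × Fin d → Prop) :
    Finite {p : List (Fin d) × Fin d // p.1.length = n ∧ q p} :=
  (((List.finite_length_eq (Fin d) n).prod (Set.finite_univ (α := Fin d))).subset
    (fun _ h => ⟨h.1, trivial⟩)).to_subtype

/-- number of vertices labelled `b` at level `n`. -/
noncomputable def cnt {A : Type*} (d n : ℕ) (t : List (Fin d) → A) (b : A) : ℕ :=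
  Nat.card {g : List (Fin d) // g.length = n ∧ t g = b}

/-- number of edges from `b` to `a` at level `n`. -/
noncomputable def ecnt {A : Type*} (d n : ℕ) (t : List (Fin d) → A) (a b : A) : ℕ :=
  Nat.card {p : List (Fin d) × Fin d // p.1.length = n ∧ t p.1 = b ∧ t (p.1 ++ [p.2]) = a}

lemma card_children {A : Type*} (d n : ℕ) (t : List (Fin d) → A) (b : A) :
    Nat.card {p : List (Fin d) × Fin d // p.1.length = n ∧ t p.1 = b} = d * cnt d n t b := by
  have e : {p : List (Fin d) × Fin d // p.1.length = n ∧ t p.1 = b} ≃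
      {g : List (Fin d) // g.length = n ∧ t g = b} × Fin d :=
    { toFun := fun p => (⟨p.1.1, p.2⟩, p.1.2)
      invFun := fun q => ⟨(q.1.1, q.2), q.1.2⟩
      left_inv := fun _ => rfl
      right_inv := fun _ => rfl }
  rw [Nat.card_congr e, Nat.card_prod, Nat.card_fin, mul_comm]; rfl

lemma cnt_succ {A : Type*} [Fintype A] (d n : ℕ) (t : List (Fin d) → A) (a : A) :
    cnt d (n + 1) t a = ∑ b, ecnt d n t a b := by
  have : ∀ b, Finite {p : List (Fin d) × Fin d //
      p.1.length = n ∧ t p.1 = b ∧ t (p.1 ++ [p.2]) = a} := fun b => fin_pairs d n _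
  unfold ecnt cnt
  rw [← Nat.card_sigma]
  symm
  refine Nat.card_congr (Equiv.ofBijective
    (fun s => ⟨s.2.1.1 ++ [s.2.1.2], by simp [s.2.2.1], s.2.2.2.2⟩) ⟨?_, ?_⟩)
  · rintro ⟨b, ⟨⟨g, i⟩, h1, h2, h3⟩⟩ ⟨b', ⟨⟨g', i'⟩, h1', h2', h3'⟩⟩ h
    simp only [Subtype.mk.injEq] at h
    obtain ⟨rfl, h⟩ := List.append_inj' h rfl
    obtain rfl : i = i' := by simpa using h
    subst h2
    subst h2'
    rfl
  · rintro ⟨w, hw, hwa⟩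
    have hne : w ≠ [] := by rintro rfl; simp at hw
    refine ⟨⟨t w.dropLast, ⟨(w.dropLast, w.getLast hne), by simp [hw], rfl, ?_⟩⟩, ?_⟩
    · simp [List.dropLast_append_getLast, hwa]
    · simp [List.dropLast_append_getLast]

lemma ecnt_le {A : Type*} (d n : ℕ) (t : List (Fin d) → A) (a b : A) :
    ecnt d n t a b ≤ d * cnt d n t b := by
  rw [← card_children]
  have := fin_pairs d n (fun p => t p.1 = b)
  exact Nat.card_le_card_of_injective
    (fun p => (⟨p.1, p.2.1, p.2.2.1⟩ : {p : List (Fin d) × Fin d // p.1.length = n ∧ t p.1 = b}))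
    (fun p q h => by simpa [Subtype.ext_iff] using h)

lemma pivec_succ {A : Type*} [Fintype A] (d n : ℕ) (hd : 2 ≤ d) (E : Matrix A A ℝ)
    (t : List (Fin d) → A) (a : A) :
    pivec d (n + 1) t a = ∑ b, Qmat d E n t a b * pivec d n t b := by
  have hd0 : (d : ℝ) ≠ 0 := by positivity
  have h1 : pivec d (n + 1) t a = (cnt d (n + 1) t a : ℝ) / (d : ℝ) ^ (n + 1) := rfl
  rw [h1, cnt_succ]
  push_cast
  rw [Finset.sum_div]
  refine Finset.sum_congr rfl fun b _ => ?_
  have h2 : pivec d n t b = (cnt d n t b : ℝ) / (d : ℝ) ^ n := rfl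
  have h3 : Qmat d E n t a b = if cnt d n t b = 0 then E a b / ∑ c, E c b else
    (ecnt d n t a b : ℝ) / (d * (cnt d n t b : ℝ)) := rfl
  rw [h2, h3]
  split_ifs with h
  · have := ecnt_le d n t a b
    rw [h] at this ⊢
    have h0 : ecnt d n t a b = 0 := by simpa using this
    simp [h0]
  · have : (cnt d n t b : ℝ) ≠ 0 := by exact_mod_cast h
    field_simp
    ring

lemma cnt_congr {A : Type*} (d n : ℕ) (t t' : List (Fin d) → A) (b : A)
    (h : ∀ g, g.length = n → t g = t' g) : cnt d n t b = cnt d n t' b := by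
  unfold cnt
  refine Nat.card_congr (Equiv.subtypeEquivRight fun g => and_congr_right fun hg => ?_)
  rw [h g hg]

lemma ecnt_congr {A : Type*} (d n : ℕ) (t t' : List (Fin d) → A) (a b : A)
    (h : ∀ g, g.length ≤ n + 1 → t g = t' g) : ecnt d n t a b = ecnt d n t' a b := by
  unfold ecnt
  refine Nat.card_congr (Equiv.subtypeEquivRight fun g => and_congr_right fun hg => ?_)
  rw [h g.1 (by omega), h (g.1 ++ [g.2]) (by simp [hg])]

lemma pivec_congr {A : Type*} (d n : ℕ) (t t' : List (Fin d) → A)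
    (h : ∀ g, g.length = n → t g = t' g) : pivec d n t = pivec d n t' := by
  funext b
  have := cnt_congr d n t t' b h
  show (cnt d n t b : ℝ) / _ = (cnt d n t' b : ℝ) / _
  rw [this]

lemma Qmat_eq {A : Type*} [Fintype A] (d n : ℕ) (E : Matrix A A ℝ) (t : List (Fin d) → A)
    (a b : A) : Qmat d E n t a b = if cnt d n t b = 0 then E a b / ∑ c, E c b else
    (ecnt d n t a b : ℝ) / (d * (cnt d n t b : ℝ)) := rfl

lemma Qmat_congr {A : Type*} [Fintype A] (d n : ℕ) (E : Matrix A A ℝ) (t t' : List (Fin d) → A)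
    (h : ∀ g, g.length ≤ n + 1 → t g = t' g) : Qmat d E n t = Qmat d E n t' := by
  ext a b
  rw [Qmat_eq, Qmat_eq, cnt_congr d n t t' b (fun g hg => h g (by omega)),
    ecnt_congr d n t t' a b h]

lemma exists_next {A : Type*} [Fintype A] (E : Matrix A A ℝ) (hE : AssumptionA E) :
    ∃ f : A → A, ∀ b, 0 < E (f b) b := by
  have : ∀ b, ∃ a, 0 < E a b := fun b => by
    obtain ⟨a, _, h⟩ := Finset.exists_lt_of_sum_lt (s := Finset.univ) (f := fun _ => (0:ℝ))
      (g := fun a => E a b) (by simpa using hE.2.1 b)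
    exact ⟨a, h⟩
  choose f hf using this
  exact ⟨f, hf⟩

lemma exists_prev {A : Type*} [Fintype A] (E : Matrix A A ℝ) (hE : AssumptionA E) :
    ∃ f : A → A, ∀ a, 0 < E a (f a) := by
  have : ∀ a, ∃ b, 0 < E a b := fun a => by
    obtain ⟨b, _, h⟩ := Finset.exists_lt_of_sum_lt (s := Finset.univ) (f := fun _ => (0:ℝ))
      (g := fun b => E a b) (by simpa using hE.2.2 a)
    exact ⟨b, h⟩
  choose f hf using this
  exact ⟨f, hf⟩

lemma extend_tree {A : Type*} [Fintype A] (d m : ℕ) (E : Matrix A A ℝ) (hE : AssumptionA E)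
    (t : List (Fin d) → A) (ht : t ∈ treeX d E) (φ : List (Fin d) → A)
    (hφ : ∀ g : List (Fin d), g.length = m → ∀ i, 0 < E (φ (g ++ [i])) (t g)) :
    ∃ t' ∈ treeX d E, (∀ g, g.length ≤ m → t' g = t g) ∧
      ∀ g, g.length = m + 1 → t' g = φ g := by
  obtain ⟨f, hf⟩ := exists_next E hE
  refine ⟨fun g => if g.length ≤ m then t g else f^[g.length - (m + 1)] (φ (g.take (m + 1))),
    ?_, ?_, ?_⟩
  · intro g i
    rcases lt_trichotomy g.length m with h | h | h
    · have h1 : (g ++ [i]).length ≤ m := by simp; omega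
      simp only [h1, h.le, if_true]
      exact ht g i
    · have h1 : ¬ (g ++ [i]).length ≤ m := by simp; omega
      simp only [h1, h.le, if_true, if_false]
      rw [List.take_of_length_le (by simp; omega)]
      simpa [h] using hφ g h i
    · have h1 : ¬ (g ++ [i]).length ≤ m := by simp; omega
      have h2 : ¬ g.length ≤ m := by omega
      simp only [h1, h2, if_false]
      have h3 : (g ++ [i]).length - (m + 1) = (g.length - (m + 1)) + 1 := by simp; omega
      rw [h3, Function.iterate_succ_apply', List.take_append_of_le_length (by omega)]
      exact hf _
  · intro g hg; simp [hg]
  · intro g hg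
    simp [hg, List.take_of_length_le]

lemma base_tree {A : Type*} [Fintype A] [DecidableEq A] (d n : ℕ) (hd : 2 ≤ d)
    (E : Matrix A A ℝ) (hE : AssumptionA E)
    (a : A) : ∃ t ∈ treeX d E, ∀ b, cnt d n t b = if b = a then d ^ n else 0 := by
  obtain ⟨f, hf⟩ := exists_next E hE
  obtain ⟨p, hp⟩ := exists_prev E hE
  refine ⟨fun g => if g.length ≤ n then p^[n - g.length] a else f^[g.length - n] a, ?_, ?_⟩
  · intro g i
    rcases lt_or_ge g.length n with h | h
    · have h1 : (g ++ [i]).length ≤ n := by simp; omega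
      simp only [h1, h.le, if_true]
      have h3 : n - g.length = (n - (g ++ [i]).length) + 1 := by simp; omega
      rw [h3, Function.iterate_succ_apply']
      exact hp _
    · have h1 : ¬ (g ++ [i]).length ≤ n := by simp; omega
      have h3 : (g ++ [i]).length - n = (g.length - n) + 1 := by simp; omega
      simp only [h1, if_false]
      rw [h3, Function.iterate_succ_apply']
      split_ifs with h2
      · have : g.length = n := by omega
        simpa [this] using hf a
      · exact hf _
  · intro b
    rw [cnt_congr d n _ (fun _ => a) b (fun g hg => by simp [hg])]
    unfold cnt
    split_ifs with h
    · subst h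
      simp only [and_true]
      have : Nat.card (List.Vector (Fin d) n) = d ^ n := by
        rw [Nat.card_eq_fintype_card, card_vector, Fintype.card_fin]
      exact this
    · have : IsEmpty {g : List (Fin d) // g.length = n ∧ a = b} := ⟨fun g => h g.2.2.symm⟩
      exact Nat.card_of_isEmpty

/-- Realize prescribed edge counts. -/
lemma realize_counts {A : Type*} [Fintype A] [DecidableEq A] (d m : ℕ)
    (E : Matrix A A ℝ) (hE : AssumptionA E) (t : List (Fin d) → A) (ht : t ∈ treeX d E)
    (c : A → A → ℕ) (hc : ∀ b, ∑ a, c a b = d * cnt d m t b)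
    (hcE : ∀ a b, c a b ≠ 0 → 0 < E a b) :
    ∃ t' ∈ treeX d E, (∀ g, g.length ≤ m → t' g = t g) ∧
      ∀ a b, ecnt d m t' a b = c a b := by
  have hfin : ∀ b, Finite {p : List (Fin d) × Fin d // p.1.length = m ∧ t p.1 = b} :=
    fun b => fin_pairs d m _
  have he : ∀ b, Nonempty ({p : List (Fin d) × Fin d // p.1.length = m ∧ t p.1 = b} ≃
      Σ a, Fin (c a b)) := fun b => by
    have := hfin b
    refine Finite.card_eq.1 ?_
    rw [card_children, ← hc b]
    simp [Nat.card_sigma]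
  let e := fun b => (he b).some
  let F : List (Fin d) × Fin d → A := fun p =>
    if h : p.1.length = m then (e (t p.1) ⟨p, h, rfl⟩).1 else t p.1
  have hF : ∀ b (p : {p : List (Fin d) × Fin d // p.1.length = m ∧ t p.1 = b}),
      F p.1 = (e b p).1 := by
    rintro b ⟨p, h1, rfl⟩
    simp [F, h1]
  let φ : List (Fin d) → A := fun w => if h : w ≠ [] then F (w.dropLast, w.getLast h) else t []
  have hφF : ∀ g i, φ (g ++ [i]) = F (g, i) := by
    intro g i; simp [φ]
  obtain ⟨t', ht', h1, h2⟩ := extend_tree d m E hE t ht φ (by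
    intro g hg i
    rw [hφF, hF (t g) ⟨(g, i), hg, rfl⟩]
    apply hcE
    have := (e (t g) ⟨(g, i), hg, rfl⟩).2
    intro h0
    have := this.2
    omega)
  refine ⟨t', ht', h1, fun a b => ?_⟩
  have e1 : {p : List (Fin d) × Fin d // p.1.length = m ∧ t' p.1 = b ∧ t' (p.1 ++ [p.2]) = a} ≃
      {q : {p : List (Fin d) × Fin d // p.1.length = m ∧ t p.1 = b} // (e b q).1 = a} :=
    { toFun := fun p => ⟨⟨p.1, p.2.1, by rw [← h1 _ p.2.1.le]; exact p.2.2.1⟩, by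
        rw [← hF]; exact ((hφF _ _).symm.trans (h2 _ (by simp [p.2.1])).symm).trans p.2.2.2⟩
      invFun := fun q => ⟨q.1.1, q.1.2.1, by rw [h1 _ q.1.2.1.le]; exact q.1.2.2, by
        rw [h2 _ (by simp [q.1.2.1]), hφF]; exact (hF b q.1).trans q.2⟩
      left_inv := fun _ => rfl
      right_inv := fun _ => rfl }
  have e2 : {q : {p : List (Fin d) × Fin d // p.1.length = m ∧ t p.1 = b} // (e b q).1 = a} ≃
      {s : (Σ a, Fin (c a b)) // s.1 = a} :=
    (e b).subtypeEquiv (fun q => Iff.rfl)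
  unfold ecnt
  rw [Nat.card_congr (e1.trans (e2.trans (Equiv.sigmaSubtype a)))]
  simp

lemma main_ind {A : Type*} [Fintype A] [DecidableEq A] (d : ℕ) (hd : 2 ≤ d)
    (E : Matrix A A ℝ) (hE : AssumptionA E) (k : ℕ) :
    ∀ ε : ℝ, 0 < ε → ∀ M : ℕ, ∃ n0 : ℕ, ∀ n ≥ n0, ∀ (v : ℕ → A → ℝ) (Q : ℕ → Matrix A A ℝ),
      (∃ a, v 0 = Pi.single a 1) → (∀ j ≤ k, IsProbVec (v j)) →
      (∀ j < k, IsColStochastic (Q j)) → (∀ j < k, v (j + 1) = (Q j).mulVec (v j)) →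
      (∀ j < k, Typical E (v j) (Q j)) →
      ∃ t ∈ treeX d E, (∀ j ≤ k, ∀ a, |v j a - pivec d (n + j) t a| ≤ ε) ∧
        (∀ j < k, ∀ a b, |Q j a b - Qmat d E (n + j) t a b| ≤ ε) ∧
        ∀ b, (v k b = 0 → cnt d (n + k) t b = 0) ∧ (0 < v k b → M ≤ cnt d (n + k) t b) := by
  have hd0 : (0 : ℝ) < d := by positivity
  induction k with
  | zero =>
    intro ε hε M
    refine ⟨M, fun n hn v Q hv _ _ _ _ => ?_⟩
    obtain ⟨a, ha⟩ := hv
    obtain ⟨t, ht, hcnt⟩ := base_tree d n hd E hE a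
    refine ⟨t, ht, ?_, by simp, ?_⟩
    · intro j hj b
      obtain rfl : j = 0 := by omega
      have : pivec d (n + 0) t b = (cnt d n t b : ℝ) / (d : ℝ) ^ n := rfl
      rw [this, hcnt, ha]
      by_cases h : b = a
      · subst h; simp; rw [div_self (by positivity)]; simpa using hε.le
      · simp [h, hε.le]
    · intro b
      rw [add_zero, hcnt, ha]
      by_cases h : b = a
      · subst h
        simp
        exact hn.le.trans (Nat.lt_pow_self (by omega)).le
      · simp [h]
  | succ k ih =>
    intro ε hε M
    set K : ℝ := (Fintype.card A : ℝ) with hK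
    set δ : ℝ := ε / (1 + K) with hδ
    have hK0 : 0 ≤ K := by positivity
    have hδ0 : 0 < δ := by positivity
    have hδK : δ + K * δ = ε := by rw [hδ]; field_simp
    have hδε : δ ≤ ε := by nlinarith
    obtain ⟨N0, hN0⟩ := alloc_exists (A := A) δ hδ0 M
    obtain ⟨n0, hn0⟩ := ih δ hδ0 (N0 + 1)
    refine ⟨n0, fun n hn v Q hv hvp hQ hvQ hty => ?_⟩
    obtain ⟨t, ht, hπ, hQm, hsupp⟩ := hn0 n hn v Q hv (fun j hj => hvp j (by omega))
      (fun j hj => hQ j (by omega)) (fun j hj => hvQ j (by omega)) (fun j hj => hty j (by omega))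
    have hvk := hvp k (by omega)
    have hQk := hQ k (by omega)
    have htk := hty k (by omega)
    have hal : ∀ b, ∃ c : A → ℕ, ∑ a, c a = d * cnt d (n + k) t b ∧ (∀ a, Q k a b = 0 → c a = 0) ∧
        (0 < v k b → ∀ a, (0 < Q k a b → M ≤ c a) ∧
          |(c a : ℝ) - (d * cnt d (n + k) t b : ℕ) * Q k a b| ≤ δ * (d * cnt d (n + k) t b : ℕ)) := by
      intro b
      rcases (hvk.1 b).eq_or_lt with h | h
      · refine ⟨fun _ => 0, ?_, fun _ _ => rfl, fun h' => absurd h h'.ne⟩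
        rw [(hsupp b).1 h.symm]; simp
      · have h1 := (hsupp b).2 h
        obtain ⟨c, hc, hc'⟩ := hN0 (d * cnt d (n + k) t b) (by nlinarith) (fun a => Q k a b)
          ⟨fun a => hQk.1 a b, hQk.2 b⟩
        exact ⟨c, hc, fun a => (hc' a).1, fun _ a => (hc' a).2⟩
    choose c hc1 hc2 hc3 using hal
    obtain ⟨t', ht', hag, hec⟩ := realize_counts d (n + k) E hE t ht (fun a b => c b a) hc1 (by
      intro a b h
      refine (hE.1 a b).lt_of_ne' fun h0 => h (hc2 b a (htk.1 a b h0)))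
    have hcn : ∀ b, cnt d (n + k) t' b = cnt d (n + k) t b := fun b =>
      cnt_congr d _ _ _ b (fun g hg => hag g hg.le)
    have hpi : ∀ j ≤ k, ∀ a, |v j a - pivec d (n + j) t' a| ≤ δ := by
      intro j hj a
      rw [pivec_congr d (n + j) t' t (fun g hg => hag g (by omega))]
      exact hπ j hj a
    have hQnew : ∀ a b, |Q k a b - Qmat d E (n + k) t' a b| ≤ δ := by
      intro a b
      rw [Qmat_eq, hcn]
      rcases (hvk.1 b).eq_or_lt with h | h
      · rw [if_pos ((hsupp b).1 h.symm), htk.2 a b h.symm]; simpa using hδ0.le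
      · have h1 := (hsupp b).2 h
        rw [if_neg (by omega), hec]
        have h2 := (hc3 b h a).2
        push_cast at h2
        have hpos : (0 : ℝ) < d * cnt d (n + k) t b := by
          have : (0 : ℝ) < cnt d (n + k) t b := by exact_mod_cast (by omega)
          positivity
        have h3 : Q k a b - (c b a : ℝ) / (d * cnt d (n + k) t b) =
          -(((c b a : ℝ) - d * cnt d (n + k) t b * Q k a b) / (d * cnt d (n + k) t b)) := by
          have hne := hpos.ne'
          generalize (d : ℝ) * (cnt d (n + k) t b : ℝ) = x at hne
          field_simp; ring
        rw [h3, abs_neg, abs_div, abs_of_pos hpos, div_le_iff₀ hpos]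
        exact h2
    have hpisum : ∑ b, pivec d (n + k) t' b ≤ 1 + K * δ := by
      have : ∀ b ∈ Finset.univ, pivec d (n + k) t' b ≤ v k b + δ := fun b _ => by
        have := (abs_le.1 (hpi k le_rfl b)).1; linarith
      refine (Finset.sum_le_sum this).trans ?_
      rw [Finset.sum_add_distrib, hvk.2]; simp [hK]
    refine ⟨t', ht', ?_, ?_, ?_⟩
    · intro j hj a
      rcases Nat.lt_or_ge j (k + 1) with h | h
      · exact (hpi j (by omega) a).trans hδε
      · obtain rfl : j = k + 1 := by omega
        rw [hvQ k (by omega), ← add_assoc, pivec_succ d (n + k) hd E]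
        simp only [Matrix.mulVec, dotProduct]
        rw [← Finset.sum_sub_distrib]
        refine (Finset.abs_sum_le_sum_abs _ _).trans ?_
        have hQle : ∀ a b, Q k a b ≤ 1 := fun a b => by
          rw [← hQk.2 b]
          exact Finset.single_le_sum (f := fun a => Q k a b) (fun i _ => hQk.1 i b) (Finset.mem_univ a)
        have hQm0 : ∀ a b, 0 ≤ Qmat d E (n + k) t' a b ∧ Qmat d E (n + k) t' a b ≤ 1 := by
          intro a b
          rw [Qmat_eq]
          split_ifs with h0
          · refine ⟨div_nonneg (hE.1 a b) (hE.2.1 b).le, div_le_one_of_le₀ ?_ (hE.2.1 b).le⟩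
            exact Finset.single_le_sum (f := fun a => E a b) (fun i _ => hE.1 i b) (Finset.mem_univ a)
          · refine ⟨by positivity, div_le_one_of_le₀ ?_ (by positivity)⟩
            exact_mod_cast ecnt_le d (n + k) t' a b
        have hterm : ∀ b ∈ Finset.univ, |Q k a b * v k b -
            Qmat d E (n + k) t' a b * pivec d (n + k) t' b| ≤ δ * v k b + δ := by
          intro b _
          have e : Q k a b * v k b - Qmat d E (n + k) t' a b * pivec d (n + k) t' b =
            (Q k a b - Qmat d E (n + k) t' a b) * v k b +
              Qmat d E (n + k) t' a b * (v k b - pivec d (n + k) t' b) := by ring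
          rw [e]
          refine (abs_add_le _ _).trans (add_le_add ?_ ?_)
          · rw [abs_mul, abs_of_nonneg (hvk.1 b)]
            exact mul_le_mul_of_nonneg_right (hQnew a b) (hvk.1 b)
          · rw [abs_mul, abs_of_nonneg (hQm0 a b).1]
            have := hpi k le_rfl b
            nlinarith [hQm0 a b, abs_nonneg (v k b - pivec d (n + k) t' b)]
        refine (Finset.sum_le_sum hterm).trans ?_
        rw [Finset.sum_add_distrib, ← Finset.mul_sum, hvk.2]
        simp [← hK]
        linarith
    · intro j hj a b
      rcases Nat.lt_or_ge j k with h | h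
      · rw [Qmat_congr d (n + j) E t' t (fun g hg => hag g (by omega))]
        exact (hQm j h a b).trans hδε
      · obtain rfl : j = k := by omega
        exact (hQnew a b).trans hδε
    · intro a
      rw [← add_assoc, cnt_succ, hvQ k (by omega)]
      simp only [Matrix.mulVec, dotProduct, hec]
      constructor
      · intro h
        rw [Finset.sum_eq_zero_iff_of_nonneg
          (fun b _ => mul_nonneg (hQk.1 a b) (hvk.1 b))] at h
        refine Finset.sum_eq_zero fun b hb => ?_
        rcases mul_eq_zero.1 (h b hb) with h0 | h0
        · exact hc2 b a h0
        · have h1 := hc1 b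
          rw [(hsupp b).1 h0, mul_zero] at h1
          exact Finset.sum_eq_zero_iff.1 h1 a (Finset.mem_univ a)
      · intro h
        obtain ⟨b, hb, hlt⟩ := Finset.exists_lt_of_sum_lt (s := Finset.univ)
          (f := fun _ => (0:ℝ)) (g := fun b => Q k a b * v k b) (by simpa using h)
        have hv0 : 0 < v k b := (hvk.1 b).lt_of_ne' (by rintro h0; simp [h0] at hlt)
        have hQ0 : 0 < Q k a b := (hQk.1 a b).lt_of_ne' (by rintro h0; simp [h0] at hlt)
        exact ((hc3 b hv0 a).1 hQ0).trans
          (Finset.single_le_sum (f := fun b => c b a) (fun _ _ => Nat.zero_le _) hb)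

lemma dv_nonneg {A : Type*} [Fintype A] (π τ : A → ℝ) : 0 ≤ dv π τ := by
  unfold dv; positivity

lemma dv_le {A : Type*} [Fintype A] (π τ : A → ℝ) (ε : ℝ) (h : ∀ a, |π a - τ a| ≤ ε) :
    dv π τ ≤ Fintype.card A * ε / 2 := by
  unfold dv
  have := Finset.sum_le_sum (s := Finset.univ) fun a _ => h a
  simp at this
  linarith

lemma tdist_nonneg {A : Type*} [Fintype A] (k : ℕ) (π τ : Fin (k + 1) → A → ℝ)
    (P T : Fin k → Matrix A A ℝ) : 0 ≤ tdist k π τ P T :=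
  le_max_of_le_left (Real.iSup_nonneg fun _ => dv_nonneg _ _)

/-- the reversed realizable tuples become asymptotically dense in `Γ'_k`:
`lim_{n→∞} sup_{(π,P)∈Γ'_k} inf_{(τ,T)} d_{v,V}((π,P),(τ,T)) = 0`. -/
theorem stmt12 {A : Type*} [Fintype A] [DecidableEq A] (d : ℕ) (hd : 2 ≤ d)
    (E : Matrix A A ℝ) (hE : AssumptionA E) (k : ℕ) (hk : 1 ≤ k) :
    Tendsto (fun n : ℕ =>
        sSup {s : ℝ | ∃ π P, GammaPrime E k π P ∧
          s = sInf {r : ℝ | ∃ τ T, IsReversal d E n k τ T ∧ r = tdist k π τ P T}})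
      atTop (nhds 0) := by
  rw [Metric.tendsto_atTop]
  intro η hη
  set K : ℝ := (Fintype.card A : ℝ) with hK
  have hK0 : 0 ≤ K := by positivity
  set ε : ℝ := η / (1 + K) with hε
  have hε0 : 0 < ε := by positivity
  have hKε : K * ε ≤ η := by
    have : ε * (1 + K) = η := by rw [hε]; field_simp
    nlinarith
  obtain ⟨n0, hn0⟩ := main_ind d hd E hE k ε hε0 0
  refine ⟨n0, fun n hn => ?_⟩
  have hnn : ∀ (π : Fin (k + 1) → A → ℝ) (P : Fin k → Matrix A A ℝ),
      ∀ r ∈ {r : ℝ | ∃ τ T, IsReversal d E n k τ T ∧ r = tdist k π τ P T}, 0 ≤ r := by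
    rintro π P r ⟨τ, T, -, rfl⟩
    exact tdist_nonneg _ _ _ _ _
  have hge : 0 ≤ sSup {s : ℝ | ∃ π P, GammaPrime E k π P ∧
      s = sInf {r : ℝ | ∃ τ T, IsReversal d E n k τ T ∧ r = tdist k π τ P T}} := by
    apply Real.sSup_nonneg
    rintro s ⟨π, P, -, rfl⟩
    exact Real.sInf_nonneg (hnn π P)
  rw [Real.dist_eq, sub_zero, abs_of_nonneg hge]
  refine lt_of_le_of_lt (b := η / 2) ?_ (by linarith)
  refine Real.sSup_le ?_ (by linarith)
  rintro s ⟨π, P, ⟨hp, hP, ⟨a, ha⟩, hrec, hty⟩, rfl⟩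
  let v : ℕ → A → ℝ := fun j => π ⟨k - j, by omega⟩
  let Q : ℕ → Matrix A A ℝ := fun j => P ⟨k - 1 - j, by omega⟩
  obtain ⟨t, ht, h1, h2, -⟩ := hn0 n hn v Q ⟨a, ha⟩ (fun j _ => hp _) (fun j _ => hP _)
    (by
      intro j hj
      have := hrec ⟨k - 1 - j, by omega⟩
      have e1 : (Fin.castSucc (⟨k - 1 - j, by omega⟩ : Fin k)) = ⟨k - (j + 1), by omega⟩ := by
        ext; simp; omega
      have e2 : (Fin.succ (⟨k - 1 - j, by omega⟩ : Fin k)) = ⟨k - j, by omega⟩ := by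
        ext; simp; omega
      rw [e1, e2] at this
      exact this)
    (by
      intro j hj
      have := hty ⟨k - 1 - j, by omega⟩
      have e2 : (Fin.succ (⟨k - 1 - j, by omega⟩ : Fin k)) = ⟨k - j, by omega⟩ := by
        ext; simp; omega
      rw [e2] at this
      exact this)
  refine (csInf_le ⟨0, hnn π P⟩ ⟨_, _, ⟨t, ht, fun i => rfl, fun i => rfl⟩, rfl⟩).trans ?_
  refine max_le (Real.iSup_le (fun i => ?_) (by linarith))
    (Real.iSup_le (fun i => Real.iSup_le (fun b => ?_) (by linarith)) (by linarith))
  · refine (dv_le _ _ ε fun c => ?_).trans (by linarith)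
    have := h1 (k - i) (by omega) c
    have e : (⟨k - (k - (i : ℕ)), by omega⟩ : Fin (k + 1)) = i := by ext; simp; omega
    simp only [v, e] at this
    exact this
  · refine (dv_le _ _ ε fun c => ?_).trans (by linarith)
    have := h2 (k - 1 - i) (by omega) c b
    have e : (⟨k - 1 - (k - 1 - (i : ℕ)), by omega⟩ : Fin k) = i := by ext; simp; omega
    simp only [Q, e] at this
    exact this
end
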